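/- arXiv:math/0511342 — 2 statements merged into one kernel-verified Lean document; each statement's English description precedes it below -/
import Mathlib

section
/- With the notation of Lelong's theorem, the upper semicontinuous envelope ψ* of ψ = sup_{t∈T} φ_t agrees with ψ outside a set of Lebesgue measure zero. -/
open Filter MeasureTheory

/-- Plurisubharmonicity (see `stmt_2`): upper semicontinuity plus the maximum
principle against real parts of holomorphic polynomials on closed discs of
complex lines. -/
def PSHOn {E : Type*} [NormedAddCommGroup E] [NormedSpace ℂ E]
    (f : E → EReal) (Ω : Set E) : Prop :=
  UpperSemicontinuousOn f Ω ∧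
    ∀ a b : E, (∀ z : ℂ, ‖z‖ ≤ 1 → a + z • b ∈ Ω) →
      ∀ p : Polynomial ℂ,
        (∀ z : ℂ, ‖z‖ = 1 → f (a + z • b) ≤ (((p.eval z).re : ℝ) : EReal)) →
        ∀ z : ℂ, ‖z‖ ≤ 1 → f (a + z • b) ≤ (((p.eval z).re : ℝ) : EReal)

section LelongRegularization

open Topology Metric Set

/-- An upper semicontinuous function bounded above is the pointwise limit of continuous
majorants. -/
theorem UpperSemicontinuous.exists_continuous_tendsto {X : Type*} [PseudoMetricSpace X]
    {h : X → ℝ} (hu : UpperSemicontinuous h) {M : ℝ} (hM : ∀ x, h x ≤ M) :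
    ∃ g : ℕ → X → ℝ, (∀ k, Continuous (g k)) ∧ (∀ k x, h x ≤ g k x) ∧ (∀ k x, g k x ≤ M) ∧
      ∀ x, Tendsto (fun k => g k x) atTop (𝓝 (h x)) := by
  have bdd : ∀ (k : ℕ) (x : X), BddAbove (range fun y => h y - k * dist x y) := by
    rintro k x
    refine ⟨M, ?_⟩
    rintro _ ⟨y, rfl⟩
    have : (0 : ℝ) ≤ k * dist x y := by positivity
    linarith [hM y]
  have lower : ∀ (k : ℕ) (x : X), h x ≤ ⨆ y, (h y - k * dist x y) := fun k x => by
    simpa using le_ciSup (bdd k x) x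
  have upper : ∀ (k : ℕ) (x : X), ⨆ y, (h y - k * dist x y) ≤ M := fun k x => by
    have : Nonempty X := ⟨x⟩
    refine ciSup_le fun y => ?_
    have : (0 : ℝ) ≤ k * dist x y := by positivity
    linarith [hM y]
  refine ⟨fun k x => ⨆ y, (h y - k * dist x y), fun k => ?_, lower, upper, fun x => ?_⟩
  · refine (LipschitzWith.of_le_add_mul (k : NNReal) fun x x' => ?_).continuous
    have : Nonempty X := ⟨x⟩
    refine ciSup_le fun y => ?_
    have h1 := le_ciSup (bdd k x') y
    have h2 : (k : ℝ) * dist x' y ≤ k * (dist x x' + dist x y) := by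
      gcongr
      rw [dist_comm x x']
      exact dist_triangle _ _ _
    simp only [NNReal.coe_natCast] at *
    linarith
  · have : Nonempty X := ⟨x⟩
    refine tendsto_order.2 ⟨fun c hc => .of_forall fun k => hc.trans_le (lower k x), fun c hc => ?_⟩
    obtain ⟨c', hxc', hc'⟩ := exists_between hc
    obtain ⟨δ, hδ, hball⟩ := Metric.eventually_nhds_iff.1 (hu x c' hxc')
    obtain ⟨k₀, hk₀⟩ := exists_nat_gt ((M - c') / δ)
    filter_upwards [eventually_ge_atTop k₀] with k hk
    refine lt_of_le_of_lt (ciSup_le fun y => ?_) hc'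
    have hk' : (k₀ : ℝ) ≤ k := by exact_mod_cast hk
    rcases lt_or_ge (dist x y) δ with hy | hy
    · have : (0 : ℝ) ≤ k * dist x y := by positivity
      linarith [hball (show dist y x < δ by rwa [dist_comm])]
    · rw [div_lt_iff₀ hδ] at hk₀
      have : (k₀ : ℝ) * δ ≤ k * dist x y := by gcongr
      linarith [hM y]

/-- Real parts of polynomials are uniformly dense in the continuous real functions on the unit
circle. -/
theorem exists_polynomial_re_near (g : C(sphere (0 : ℂ) 1, ℝ)) {ε : ℝ} (hε : 0 < ε) :
    ∃ p : Polynomial ℂ, ∀ z : sphere (0 : ℂ) 1, |(p.eval (z : ℂ)).re - g z| < ε := by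
  have : Fact (0 < 2 * Real.pi) := ⟨Real.two_pi_pos⟩
  let T := AddCircle (2 * Real.pi)
  have hspan : ∀ q ∈ Submodule.span ℂ (range (@fourier (2 * Real.pi))), ∀ c : ℂ,
      ∃ p : Polynomial ℂ, ∀ x : T, (c * q x).re = (p.eval (x.toCircle : ℂ)).re := by
    intro q hq
    induction hq using Submodule.span_induction with
    | mem q hq =>
      obtain ⟨n, rfl⟩ := hq
      intro c
      obtain ⟨m, rfl | rfl⟩ := n.eq_nat_or_neg
      · exact ⟨.C c * .X ^ m, fun x => by simp [AddCircle.toCircle_nsmul]⟩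
      · refine ⟨.C (starRingEnd ℂ c) * .X ^ m, fun x => ?_⟩
        rw [← Complex.conj_re]
        simp [AddCircle.toCircle_nsmul, AddCircle.toCircle_neg, -map_pow, ← Circle.coe_pow]
    | zero => exact fun c => ⟨0, by simp⟩
    | add q r _ _ hq hr =>
      intro c
      obtain ⟨p, hp⟩ := hq c
      obtain ⟨p', hp'⟩ := hr c
      exact ⟨p + p', fun x => by
        rw [ContinuousMap.add_apply, mul_add, Complex.add_re, hp, hp', Polynomial.eval_add,
          Complex.add_re]⟩
    | smul a q _ hq =>
      intro c
      obtain ⟨p, hp⟩ := hq (c * a)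
      exact ⟨p, fun x => by
        rw [← hp, ContinuousMap.smul_apply, smul_eq_mul, mul_assoc]⟩
  let G : C(T, ℂ) := ⟨fun x => (g ⟨x.toCircle,
      mem_sphere_zero_iff_norm.2 (Circle.norm_coe _)⟩ : ℂ), by
    refine Complex.continuous_ofReal.comp (g.continuous.comp ?_)
    exact (continuous_subtype_val.comp AddCircle.continuous_toCircle).subtype_mk _⟩
  have hG : G ∈ (Submodule.span ℂ (range (@fourier (2 * Real.pi)))).topologicalClosure := by
    rw [span_fourier_closure_eq_top]
    trivial
  obtain ⟨q, hq, hqG⟩ := Metric.mem_closure_iff.1 hG ε hε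
  obtain ⟨p, hp⟩ := hspan q hq 1
  refine ⟨p, fun z => ?_⟩
  let x : T := ((z : ℂ).arg : ℝ)
  have hz : (x.toCircle : ℂ) = z := by
    rw [AddCircle.toCircle_apply_mk, div_self Real.two_pi_pos.ne', one_mul, Circle.coe_exp]
    simpa using Complex.norm_mul_exp_arg_mul_I (z : ℂ)
  have h1 := hp x
  rw [hz, one_mul] at h1
  have h2 : G x = (g z : ℂ) := by
    simp only [G, ContinuousMap.coe_mk]
    congr 2
    exact Subtype.ext hz
  have h3 := (ContinuousMap.dist_apply_le_dist x).trans_lt hqG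
  rw [h2, dist_comm, dist_eq_norm] at h3
  rw [← h1]
  refine lt_of_le_of_lt ?_ h3
  simpa using Complex.abs_re_le_norm (q x - (g z : ℂ))

theorem Polynomial.re_eval_zero_eq_circleAverage (p : Polynomial ℂ) :
    (p.eval 0).re = Real.circleAverage (fun z => (p.eval z).re) 0 1 := by
  have h1 : Real.circleAverage (fun z => p.eval z) 0 1 = p.eval 0 :=
    p.differentiable.diffContOnCl.circleAverage
  rw [← h1]
  simp only [Real.circleAverage_def, Complex.real_smul, smul_eq_mul]
  have : IntervalIntegrable (fun θ => p.eval (circleMap 0 1 θ)) volume 0 (2 * Real.pi) :=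
    (p.continuous.comp (continuous_circleMap 0 1)).intervalIntegrable _ _
  rw [Complex.re_ofReal_mul]
  congr 1
  exact (Complex.reCLM.intervalIntegral_comp_comm this).symm

/-- Domination by real parts of polynomials tests integrals of upper semicontinuous functions on
the unit circle. -/
theorem UpperSemicontinuousOn.le_circleAverage_of_polynomial {h : ℂ → ℝ}
    (hu : UpperSemicontinuousOn h (sphere 0 1)) {m M : ℝ} (hm : ∀ z ∈ sphere (0 : ℂ) 1, m ≤ h z)
    (hM : ∀ z ∈ sphere (0 : ℂ) 1, h z ≤ M) {c : ℝ}
    (hc : ∀ p : Polynomial ℂ, (∀ z : ℂ, ‖z‖ = 1 → h z ≤ (p.eval z).re) → c ≤ (p.eval 0).re) :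
    c ≤ Real.circleAverage h 0 1 := by
  obtain ⟨g, hgc, hhg, hgM, hlim⟩ := UpperSemicontinuous.exists_continuous_tendsto
    (upperSemicontinuousOn_iff_restrict.2 hu) (M := M) fun x => hM x x.2
  let σ : ℝ → sphere (0 : ℂ) 1 := fun θ => ⟨circleMap 0 1 θ, circleMap_mem_sphere 0 zero_le_one θ⟩
  have hσ : Continuous σ := (continuous_circleMap 0 1).subtype_mk _
  have hle : ∀ k, c ≤ (2 * Real.pi)⁻¹ * ∫ θ in (0)..2 * Real.pi, g k (σ θ) := by
    intro k
    refine le_of_forall_pos_le_add fun ε hε => ?_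
    obtain ⟨p, hp⟩ := exists_polynomial_re_near ⟨g k, hgc k⟩ (half_pos hε)
    have h1 : c ≤ ((p + .C ((ε / 2 : ℝ) : ℂ)).eval 0).re := by
      refine hc _ fun z hz => ?_
      have h2 := hhg k ⟨z, mem_sphere_zero_iff_norm.2 hz⟩
      have h3 := (abs_lt.1 (hp ⟨z, mem_sphere_zero_iff_norm.2 hz⟩)).1
      simp only [ContinuousMap.coe_mk, Set.domRestrict_apply] at h2 h3
      rw [Polynomial.eval_add, Polynomial.eval_C, Complex.add_re, Complex.ofReal_re]
      linarith
    refine h1.trans ?_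
    rw [Polynomial.re_eval_zero_eq_circleAverage, Real.circleAverage_def, smul_eq_mul]
    have h4 : ∫ θ in (0)..2 * Real.pi, ((p + .C ((ε / 2 : ℝ) : ℂ)).eval (circleMap 0 1 θ)).re ≤
        ∫ θ in (0)..2 * Real.pi, (g k (σ θ) + ε) := by
      refine intervalIntegral.integral_mono_on Real.two_pi_pos.le ?_ ?_ fun θ _ => ?_
      · exact (Complex.continuous_re.comp ((Polynomial.continuous _).comp
          (continuous_circleMap 0 1))).intervalIntegrable _ _
      · exact (((hgc k).comp hσ).add continuous_const).intervalIntegrable _ _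
      · have := (abs_lt.1 (hp (σ θ))).2
        simp only [ContinuousMap.coe_mk, σ] at this
        rw [Polynomial.eval_add, Polynomial.eval_C, Complex.add_re, Complex.ofReal_re]
        simp only [σ]
        linarith
    have hgi : IntervalIntegrable (fun θ => g k (σ θ)) volume 0 (2 * Real.pi) :=
      ((hgc k).comp hσ).intervalIntegrable _ _
    rw [intervalIntegral.integral_add hgi (continuous_const.intervalIntegrable _ _),
      intervalIntegral.integral_const, sub_zero,
      smul_eq_mul] at h4
    calc _ ≤ (2 * Real.pi)⁻¹ * ((∫ θ in (0)..2 * Real.pi, g k (σ θ)) + 2 * Real.pi * ε) := by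
          gcongr
      _ = _ := by field_simp
  refine ge_of_tendsto' (x := atTop) ?_ hle
  rw [Real.circleAverage_def, smul_eq_mul]
  refine Tendsto.const_mul _ ?_
  refine intervalIntegral.tendsto_integral_filter_of_dominated_convergence
    (fun _ => max |m| |M|) ?_ ?_ (intervalIntegrable_const) ?_
  · exact .of_forall fun k => ((hgc k).comp hσ).aestronglyMeasurable
  · refine .of_forall fun k => .of_forall fun θ _ => ?_
    rw [Real.norm_eq_abs]
    exact abs_le_max_abs_abs ((hm _ (σ θ).2).trans (hhg k (σ θ))) (hgM k _)
  · exact .of_forall fun θ _ => hlim (σ θ)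

section Truncation

variable {X : Type*} {Ω : Set X} {f : X → EReal} {m C : ℝ} {x : X}

/-- The real-valued function `max f m` on `Ω`, extended by zero. -/
noncomputable def lowerTruncation (Ω : Set X) (m : ℝ) (f : X → EReal) : X → ℝ :=
  Ω.indicator fun x => (max (f x) m).toReal

theorem coe_lowerTruncation (hx : x ∈ Ω) (hC : f x ≤ C) :
    (lowerTruncation Ω m f x : EReal) = max (f x) m := by
  rw [lowerTruncation, indicator_of_mem hx]
  refine EReal.coe_toReal (ne_of_lt ?_) (ne_of_gt ?_)
  · exact max_lt (hC.trans_lt (EReal.coe_lt_top C)) (EReal.coe_lt_top m)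
  · exact lt_max_of_lt_right (EReal.bot_lt_coe m)

theorem lowerTruncation_mono {g : X → EReal} (hx : x ∈ Ω) (hfg : f x ≤ g x) (hC : g x ≤ C) :
    lowerTruncation Ω m f x ≤ lowerTruncation Ω m g x := by
  rw [← EReal.coe_le_coe_iff, coe_lowerTruncation hx (hfg.trans hC), coe_lowerTruncation hx hC]
  exact max_le_max_right _ hfg

theorem abs_lowerTruncation_le (hC : ∀ x ∈ Ω, f x ≤ C) (x : X) :
    |lowerTruncation Ω m f x| ≤ max |m| |max C m| := by
  by_cases hx : x ∈ Ω
  · have h := coe_lowerTruncation (m := m) hx (hC x hx)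
    refine abs_le_max_abs_abs ?_ ?_
    · rw [← EReal.coe_le_coe_iff, h]
      exact le_max_right _ _
    · rw [← EReal.coe_le_coe_iff, h, EReal.coe_strictMono.monotone.map_max]
      exact max_le_max_right _ (hC x hx)
  · rw [lowerTruncation, indicator_of_notMem hx, abs_zero]
    exact le_max_of_le_left (abs_nonneg m)

theorem UpperSemicontinuousOn.measurable_indicator [TopologicalSpace X] [MeasurableSpace X]
    [OpensMeasurableSpace X] (hf : UpperSemicontinuousOn f Ω) (hΩ : IsOpen Ω) :
    Measurable (Ω.indicator f) := by
  refine measurable_of_restrict_of_restrict_compl hΩ.measurableSet ?_ ?_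
  · convert (upperSemicontinuousOn_iff_restrict.2 hf).measurable using 1
    ext x
    simp
  · convert measurable_const (a := (0 : EReal)) using 1
    ext x
    simp [indicator_of_notMem x.2]

theorem measurable_lowerTruncation [MeasurableSpace X] (hΩ : MeasurableSet Ω)
    (hf : Measurable (Ω.indicator f)) : Measurable (lowerTruncation Ω m f) := by
  have : lowerTruncation Ω m f = Ω.indicator fun x => (max (Ω.indicator f x) m).toReal := by
    unfold lowerTruncation
    exact indicator_congr fun x hx => by rw [indicator_of_mem hx]
  rw [this]
  exact (hf.max measurable_const).ereal_toReal.indicator hΩ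

theorem integrableOn_comp_lowerTruncation [MeasurableSpace X] {Y : Type*} [MeasurableSpace Y]
    {μ : Measure Y} {s : Set Y} (hs : μ s ≠ ⊤) {u : Y → X} (hu : Measurable u)
    (hΩ : MeasurableSet Ω) (hf : Measurable (Ω.indicator f)) (hC : ∀ x ∈ Ω, f x ≤ C) :
    IntegrableOn (fun y => lowerTruncation Ω m f (u y)) s μ :=
  Measure.integrableOn_of_bounded hs
    ((measurable_lowerTruncation hΩ hf).comp hu).aestronglyMeasurable
    (.of_forall fun y => abs_lowerTruncation_le hC (u y))

end Truncation

section PSH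

variable {E : Type*} [NormedAddCommGroup E] [NormedSpace ℂ E] {Ω : Set E} {f : E → EReal}
  {m C : ℝ}

theorem PSHOn.mono {Ω' : Set E} (hf : PSHOn f Ω) (h : Ω' ⊆ Ω) : PSHOn f Ω' :=
  ⟨hf.1.mono h, fun a b hab => hf.2 a b fun z hz => h (hab z hz)⟩

theorem PSHOn.lowerTruncation_le_circleAverage (hf : PSHOn f Ω) (hC : ∀ x ∈ Ω, f x ≤ C) {a b : E}
    (hab : ∀ z : ℂ, ‖z‖ ≤ 1 → a + z • b ∈ Ω) :
    lowerTruncation Ω m f a ≤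
      Real.circleAverage (fun z => lowerTruncation Ω m f (a + z • b)) 0 1 := by
  have hab' : ∀ z ∈ sphere (0 : ℂ) 1, a + z • b ∈ Ω := fun z hz =>
    hab z (mem_sphere_zero_iff_norm.1 hz).le
  have ha : a ∈ Ω := by simpa using hab 0 (by simp)
  have hbound := abs_lowerTruncation_le (m := m) hC
  refine UpperSemicontinuousOn.le_circleAverage_of_polynomial (fun z hz c hc => ?_)
    (fun z _ => (abs_le.1 (hbound (a + z • b))).1) (fun z _ => (abs_le.1 (hbound _)).2)
    fun p hp => ?_
  · change lowerTruncation Ω m f (a + z • b) < c at hc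
    rw [← EReal.coe_lt_coe_iff, coe_lowerTruncation (hab' z hz) (hC _ (hab' z hz)),
      max_lt_iff] at hc
    have ht : Tendsto (fun z : ℂ => a + z • b) (𝓝[sphere 0 1] z) (𝓝[Ω] (a + z • b)) := by
      refine tendsto_nhdsWithin_iff.2 ⟨?_, ?_⟩
      · exact (show Continuous fun z : ℂ => a + z • b by fun_prop).continuousWithinAt
      · filter_upwards [self_mem_nhdsWithin] with w hw using hab' w hw
    filter_upwards [ht.eventually (hf.1 _ (hab' z hz) c hc.1), self_mem_nhdsWithin] with w hw hw'
    change lowerTruncation Ω m f (a + w • b) < c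
    rw [← EReal.coe_lt_coe_iff, coe_lowerTruncation (hab' w hw') (hC _ (hab' w hw'))]
    exact max_lt hw hc.2
  · have hp' : ∀ z : ℂ, ‖z‖ = 1 → max (f (a + z • b)) m ≤ ((p.eval z).re : EReal) := by
      intro z hz
      have hz' := hab z hz.le
      rw [← coe_lowerTruncation hz' (hC _ hz')]
      exact EReal.coe_le_coe_iff.2 (hp z hz)
    rw [← EReal.coe_le_coe_iff, coe_lowerTruncation ha (hC a ha)]
    refine max_le ?_ (EReal.coe_le_coe_iff.2 ?_)
    · simpa using hf.2 a b hab p (fun z hz => (le_max_left _ _).trans (hp' z hz)) 0 (by simp)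
    · rw [Polynomial.re_eval_zero_eq_circleAverage, ← Real.circleAverage_const m 0 1]
      refine Real.circleAverage_mono (by simp) ?_ fun z hz => ?_
      · exact (Complex.continuous_re.comp p.continuous).continuousOn.circleIntegrable zero_le_one
      · rw [abs_one, mem_sphere_zero_iff_norm] at hz
        exact EReal.coe_le_coe_iff.1 ((le_max_right _ _).trans (hp' z hz))

end PSH

theorem measurePreserving_circleMap_smul (n : ℕ) (θ : ℝ) :
    MeasurePreserving (fun x : Fin n → ℂ => circleMap 0 1 θ • x) := by
  have h := LinearIsometryEquiv.measurePreserving (rotation (Circle.exp θ))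
  have h2 := volume_preserving_pi (fun _ : Fin n => h)
  convert h2 using 1
  ext x i
  simp [circleMap]

theorem PSHOn.lowerTruncation_le_average {n : ℕ} {Ω : Set (Fin n → ℂ)} (hΩ : IsOpen Ω)
    {f : (Fin n → ℂ) → EReal} (hf : PSHOn f Ω) {m C : ℝ} (hC : ∀ x ∈ Ω, f x ≤ C)
    {a : Fin n → ℂ} {r : ℝ} (hr : 0 < r) (har : closedBall a r ⊆ Ω) :
    lowerTruncation Ω m f a ≤ ⨍ x in closedBall a r, lowerTruncation Ω m f x := by
  set U := lowerTruncation Ω m f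
  have hmeas := hf.1.measurable_indicator hΩ
  set B : Set (Fin n → ℂ) := closedBall 0 r with hB
  have hBfin : volume B ≠ ⊤ := measure_closedBall_lt_top.ne
  have hBpos : 0 < volume.real B :=
    ENNReal.toReal_pos (measure_closedBall_pos volume 0 hr).ne' hBfin
  have htrans : ∫ x in closedBall a r, U x = ∫ y in B, U (a + y) := by
    rw [← (measurePreserving_add_left volume a).setIntegral_preimage_emb
      (measurableEmbedding_addLeft a)]
    simp [hB]
  have hrot : ∀ θ : ℝ, ∫ y in B, U (a + circleMap 0 1 θ • y) = ∫ y in B, U (a + y) := by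
    intro θ
    have hne : circleMap 0 1 θ ≠ 0 := circleMap_ne_center one_ne_zero
    rw [← (measurePreserving_circleMap_smul n θ).setIntegral_preimage_emb
      (measurableEmbedding_const_smul₀ hne) fun y => U (a + y)]
    congr 2
    ext y
    simp [hB, norm_smul]
  have hprod : IntegrableOn (fun q : ℝ × (Fin n → ℂ) => U (a + circleMap 0 1 q.1 • q.2))
      (Ioc 0 (2 * Real.pi) ×ˢ B) (volume.prod volume) := by
    refine integrableOn_comp_lowerTruncation ?_ ?_ hΩ.measurableSet hmeas hC
    · rw [Measure.prod_prod]
      exact ENNReal.mul_ne_top measure_Ioc_lt_top.ne hBfin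
    · exact (continuous_const.add (((continuous_circleMap 0 1).comp continuous_fst).smul
        continuous_snd)).measurable
  have hprod' : Integrable (fun q : ℝ × (Fin n → ℂ) => U (a + circleMap 0 1 q.1 • q.2))
      ((volume.restrict (Ioc 0 (2 * Real.pi))).prod (volume.restrict B)) := by
    rwa [Measure.prod_restrict]
  have hint : ∫ y in B, Real.circleAverage (fun z => U (a + z • y)) 0 1 = ∫ y in B, U (a + y) := by
    simp only [Real.circleAverage_def, smul_eq_mul, intervalIntegral.integral_of_le
      Real.two_pi_pos.le]
    rw [integral_const_mul, ← integral_integral_swap hprod']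
    simp only [hrot, setIntegral_const, smul_eq_mul]
    rw [Real.volume_real_Ioc_of_le Real.two_pi_pos.le, sub_zero,
      inv_mul_cancel_left₀ Real.two_pi_pos.ne']
  have hle : ∫ _ in B, U a ≤ ∫ y in B, Real.circleAverage (fun z => U (a + z • y)) 0 1 := by
    refine setIntegral_mono_on (integrableOn_const hBfin) ?_ measurableSet_closedBall
      fun y hy => hf.lowerTruncation_le_circleAverage hC fun z hz => har ?_
    · simp only [Real.circleAverage_def, intervalIntegral.integral_of_le Real.two_pi_pos.le]
      exact hprod'.integral_prod_right.smul (2 * Real.pi)⁻¹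
    · rw [mem_closedBall_zero_iff] at hy
      rw [mem_closedBall_iff_norm, add_sub_cancel_left, norm_smul]
      nlinarith [norm_nonneg z, norm_nonneg y]
  rw [hint, ← htrans, setIntegral_const, smul_eq_mul] at hle
  have hvol : volume.real (closedBall a r) = volume.real B := by
    rw [Measure.real, Measure.real, hB, Measure.addHaar_closedBall_center]
  rw [setAverage_eq, smul_eq_mul, ← div_eq_inv_mul, hvol, le_div_iff₀ hBpos, mul_comm]
  exact hle

/-- The supremum of a countable family of plurisubharmonic functions is upper semicontinuous at
almost every point. -/
theorem ae_eventually_iSup_lt_of_psh {n : ℕ} {ι : Type*} [Countable ι] {Ω : Set (Fin n → ℂ)}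
    (hΩ : IsOpen Ω) {φ : ι → (Fin n → ℂ) → EReal} (hφ : ∀ i, PSHOn (φ i) Ω) {C : ℝ}
    (hC : ∀ i, ∀ x ∈ Ω, φ i x ≤ C) :
    ∀ᵐ x, x ∈ Ω → ∀ q : ℝ, ⨆ i, φ i x < q → ∀ᶠ y in 𝓝 x, ⨆ i, φ i y < q := by
  have hmeas : Measurable (Ω.indicator fun x => ⨆ i, φ i x) := by
    have : Ω.indicator (fun x => ⨆ i, φ i x) = Ω.indicator fun x => ⨆ i, Ω.indicator (φ i) x :=
      indicator_congr fun x hx => by simp only [indicator_of_mem hx]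
    rw [this]
    exact (Measurable.iSup fun i => (hφ i).1.measurable_indicator hΩ).indicator hΩ.measurableSet
  have hψC : ∀ x ∈ Ω, ⨆ i, φ i x ≤ (C : EReal) := fun x hx => iSup_le fun i => hC i x hx
  have hloc (m : ℝ) : LocallyIntegrable (lowerTruncation Ω m fun x => ⨆ i, φ i x) volume := by
    rw [locallyIntegrable_iff]
    intro K hK
    exact integrableOn_comp_lowerTruncation hK.measure_lt_top.ne measurable_id hΩ.measurableSet
      hmeas hψC
  have hleb := ae_all_iff.2 fun N : ℕ =>
    IsUnifLocDoublingMeasure.ae_tendsto_average volume (hloc (-N)) 1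
  filter_upwards [hleb] with x hx hxΩ q hq
  obtain ⟨N, hN⟩ := exists_nat_gt (-q)
  have hxq : lowerTruncation Ω (-N) (fun x => ⨆ i, φ i x) x < q := by
    rw [← EReal.coe_lt_coe_iff, coe_lowerTruncation hxΩ (hψC x hxΩ)]
    exact max_lt hq (EReal.coe_lt_coe_iff.2 (by linarith))
  have hδ : Tendsto (fun y => dist y x) (𝓝[≠] x) (𝓝[>] 0) := by
    refine tendsto_nhdsWithin_iff.2 ⟨?_, ?_⟩
    · have : Tendsto (fun y => dist y x) (𝓝 x) (𝓝 (dist x x)) :=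
        (continuous_id.dist continuous_const).tendsto x
      rw [dist_self] at this
      exact this.mono_left nhdsWithin_le_nhds
    · filter_upwards [self_mem_nhdsWithin] with y hy using dist_pos.2 hy
  have havg := (hx N (fun y => y) _ hδ
    (.of_forall fun y => by simp [dist_comm])).eventually_lt_const hxq
  obtain ⟨ε, hε, hball⟩ := Metric.isOpen_iff.1 hΩ x hxΩ
  rw [eventually_nhdsWithin_iff] at havg
  filter_upwards [havg, ball_mem_nhds x (half_pos hε)] with y hy hyε
  rcases eq_or_ne y x with rfl | hyx
  · exact hq
  refine lt_of_le_of_lt (iSup_le fun i => ?_) (EReal.coe_lt_coe_iff.2 (hy hyx))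
  have hsub : closedBall y (dist y x) ⊆ Ω := by
    refine (closedBall_subset_ball' ?_).trans hball
    rw [mem_ball] at hyε
    linarith
  have hyΩ : y ∈ Ω := hsub (mem_closedBall_self dist_nonneg)
  calc φ i y ≤ lowerTruncation Ω (-N) (φ i) y := by
        rw [coe_lowerTruncation hyΩ (hC i y hyΩ)]
        exact le_max_left _ _
    _ ≤ _ := EReal.coe_le_coe_iff.2 <|
      ((hφ i).lowerTruncation_le_average hΩ (hC i) (dist_pos.2 hyx) hsub).trans ?_
  rw [setAverage_eq, setAverage_eq]
  refine smul_le_smul_of_nonneg_left ?_ (by positivity)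
  have hfin : volume (closedBall y (dist y x)) ≠ ⊤ := measure_closedBall_lt_top.ne
  refine setIntegral_mono_on ?_ ?_ measurableSet_closedBall fun z hz =>
    lowerTruncation_mono (hsub hz) (le_iSup (fun i => φ i z) i) (hψC z (hsub hz))
  · exact integrableOn_comp_lowerTruncation hfin measurable_id hΩ.measurableSet
      ((hφ i).1.measurable_indicator hΩ) (hC i)
  · exact integrableOn_comp_lowerTruncation hfin measurable_id hΩ.measurableSet hmeas hψC

/-- Choquet's lemma: a countable subfamily has a supremum with the same upper bounds on small
open sets. -/
theorem exists_countable_subfamily_iSup_le {X T : Type*} [TopologicalSpace X]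
    [SecondCountableTopology X] (Ω : Set X) (φ : T → X → EReal) :
    ∃ S : Set T, S.Countable ∧ ∀ x, ∀ q : ℚ,
      (∀ᶠ y in 𝓝 x, ⨆ t : S, φ t y < ((q : ℝ) : EReal)) →
        ∀ᶠ y in 𝓝[Ω] x, ⨆ t, φ t y ≤ ((q : ℝ) : EReal) := by
  let P := {p : TopologicalSpace.countableBasis X × ℚ //
    ∃ t, ∃ z ∈ (p.1 : Set X) ∩ Ω, ((p.2 : ℝ) : EReal) < φ t z}
  let τ : P → T := fun p => p.2.choose
  have hτ : ∀ p : P, ∃ z ∈ (p.1.1 : Set X) ∩ Ω, ((p.1.2 : ℝ) : EReal) < φ (τ p) z :=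
    fun p => p.2.choose_spec
  refine ⟨range τ, countable_range τ, fun x q hq => ?_⟩
  obtain ⟨b, hb, hxb, hbq⟩ :=
    (TopologicalSpace.isBasis_countableBasis X).mem_nhds_iff.1 hq
  have hbx : b ∈ 𝓝 x := (TopologicalSpace.isOpen_of_mem_countableBasis hb).mem_nhds hxb
  filter_upwards [mem_nhdsWithin_of_mem_nhds hbx, self_mem_nhdsWithin] with y hyb hyΩ
  refine iSup_le fun t => le_of_not_gt fun ht => ?_
  obtain ⟨z, hz, hzq⟩ := hτ ⟨(⟨b, hb⟩, q), t, y, ⟨hyb, hyΩ⟩, ht⟩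
  refine lt_irrefl _ ((hzq.trans_le ?_).trans (hbq hz.1))
  exact le_iSup (fun t : range τ => φ t z) ⟨_, mem_range_self _⟩

end LelongRegularization

/-- With the notation of Lelong's theorem, the upper semicontinuous envelope
`ψ*` of `ψ = sup_{t ∈ T} φ_t` agrees with `ψ` outside a set of Lebesgue
measure zero. -/
theorem lelong_regularization_ae_eq
    {n : ℕ} {T : Type*}
    (Ω : Set (Fin n → ℂ)) (hΩo : IsOpen Ω)
    (φ : T → (Fin n → ℂ) → EReal)
    (hpsh : ∀ t, PSHOn (φ t) Ω)
    (hbdd : ∀ K : Set (Fin n → ℂ), K ⊆ Ω → IsCompact K →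
      ∃ C : ℝ, ∀ t, ∀ x ∈ K, φ t x ≤ ((C : ℝ) : EReal)) :
    let ψ : (Fin n → ℂ) → EReal := fun x => ⨆ t, φ t x
    let ψs : (Fin n → ℂ) → EReal := fun x => limsup ψ (nhdsWithin x Ω)
    volume {x | x ∈ Ω ∧ ψ x ≠ ψs x} = 0 := by
  intro ψ ψs
  obtain ⟨S, hS, hSq⟩ := exists_countable_subfamily_iSup_le Ω φ
  have := hS.to_subtype
  refine measure_null_of_locally_null _ fun x₀ hx₀ => ?_
  obtain ⟨r, hr, hrΩ⟩ := Metric.nhds_basis_closedBall.mem_iff.1 (hΩo.mem_nhds hx₀.1)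
  have hballΩ := Metric.ball_subset_closedBall.trans hrΩ
  obtain ⟨C, hC⟩ := hbdd _ hrΩ (isCompact_closedBall x₀ r)
  refine ⟨{x | x ∈ Ω ∧ ψ x ≠ ψs x} ∩ Metric.ball x₀ r,
    Filter.inter_mem self_mem_nhdsWithin
      (mem_nhdsWithin_of_mem_nhds (Metric.ball_mem_nhds _ hr)), ?_⟩
  rw [measure_eq_zero_iff_ae_notMem]
  filter_upwards [ae_eventually_iSup_lt_of_psh (φ := fun t : S => φ t) Metric.isOpen_ball
    (fun t => (hpsh t).mono hballΩ)
    fun t x hx => hC t x (Metric.ball_subset_closedBall hx)] with x hx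
  rintro ⟨⟨hxΩ, hne⟩, hxr⟩
  refine hne (le_antisymm ?_ (le_of_forall_gt fun q hq => ?_))
  · refine le_limsup_of_frequently_le' fun h => ?_
    exact h.self_of_nhdsWithin hxΩ le_rfl
  · obtain ⟨s, hs, hsq⟩ := EReal.lt_iff_exists_rat_btwn.1 hq
    have hle : ⨆ t : S, φ t x ≤ ψ x := iSup_le fun t => le_iSup (fun t => φ t x) t
    exact (limsup_le_of_le (by isBoundedDefault)
      (hSq x s (hx hxr s (hle.trans_lt hs)))).trans_lt hsq
end

section
/- Sub-mean value bound propagates through the dynamical system of Bergman kernels: if K_m(x) = sup{|σ(x)|² : σ ∈ V_m, ∫ K_{m-1}^{-1}|σ|² dV ≤ 1} where V_m ⊆ H⁰ are finite-dimensional spaces of dimension ≤ C m^ν, and the weight satisfies a local sub-mean value inequality, then there exists C₁ > 0 with K_m ≤ C₁^m (m!)^ν dV^m pointwise (upper bound in the dynamical construction of AZD, stated for the local model on a polydisk). -/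
open MeasureTheory
open scoped ENNReal

open Metric Real Filter in
/-- Subharmonicity of `|f| ^ p` on the unit disc, for every exponent `p > 0`. -/
theorem norm_rpow_le_circleAverage {f : ℂ → ℂ} {p : ℝ} (hp : 0 < p)
    (hf : AnalyticOnNhd ℂ f (closedBall 0 1)) :
    ‖f 0‖ ^ p ≤ circleAverage (fun z ↦ ‖f z‖ ^ p) 0 1 := by
  have hpow : CircleIntegrable (fun z ↦ ‖f z‖ ^ p) 0 1 := by
    apply ContinuousOn.circleIntegrable zero_le_one
    exact ((hf.continuousOn.mono sphere_subset_closedBall).norm).rpow_const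
      fun _ _ ↦ Or.inr hp.le
  rcases eq_or_ne (f 0) 0 with h0 | h0
  · rw [h0, norm_zero, zero_rpow hp.ne']
    exact circleAverage_nonneg_of_nonneg fun _ _ ↦ by positivity
  have ha : 0 < ‖f 0‖ := norm_pos_iff.2 h0
  have hlog : log ‖f 0‖ ≤ circleAverage (log ‖f ·‖) 0 1 := by
    have hf' : AnalyticOnNhd ℂ f (closedBall 0 |1|) := by simpa using hf
    rw [hf'.circleAverage_log_norm one_ne_zero h0]
    refine le_add_of_nonneg_left (finsum_nonneg fun u ↦ ?_)
    by_cases hu : u ∈ closedBall (0 : ℂ) |1|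
    · have h1 := MeromorphicOn.AnalyticOnNhd.divisor_nonneg hf' u
      refine mul_nonneg (by exact_mod_cast h1) ?_
      simp only [zero_sub, norm_neg, one_mul, log_inv]
      have : ‖u‖ ≤ 1 := by simpa using hu
      simpa using log_nonpos (norm_nonneg u) this
    · rw [Function.locallyFinsuppWithin.apply_eq_zero_of_notMem _ hu]
      simp
  set L : ℂ → ℝ := fun z ↦ if f z = 0 then log ‖f 0‖ - 1 / p else log ‖f z‖ with hL
  have hcod : (log ‖f ·‖) =ᶠ[codiscreteWithin (sphere 0 |1|)] L := by
    have h1 : f ⁻¹' {0}ᶜ ∈ codiscreteWithin (closedBall (0 : ℂ) 1) :=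
      hf.preimage_zero_mem_codiscreteWithin (x := 0) h0 (by simp)
        ⟨nonempty_closedBall.2 zero_le_one, (convex_closedBall _ _).isPreconnected⟩
    have h2 := codiscreteWithin_mono (sphere_subset_closedBall (x := (0 : ℂ)) (ε := 1)) h1
    rw [abs_one]
    filter_upwards [h2] with z hz
    have : f z ≠ 0 := by simpa using hz
    simp [hL, this]
  have hLi : CircleIntegrable L 0 1 := by
    refine CircleIntegrable.congr_codiscreteWithin hcod ?_
    apply MeromorphicOn.circleIntegrable_log_norm
    exact fun z hz ↦ (hf z (sphere_subset_closedBall (by simpa using hz))).meromorphicAt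
  rw [circleAverage_congr_codiscreteWithin hcod one_ne_zero] at hlog
  have hle : circleAverage (fun z ↦ ‖f 0‖ ^ p * (1 + p * (L z - log ‖f 0‖))) 0 1 ≤
      circleAverage (fun z ↦ ‖f z‖ ^ p) 0 1 := by
    refine circleAverage_mono ?_ hpow fun z _ ↦ ?_
    · have : CircleIntegrable (fun z ↦ p * (L z - log ‖f 0‖)) 0 1 :=
        (hLi.sub (circleIntegrable_const (log ‖f 0‖) 0 1)).const_mul p
      exact ((circleIntegrable_const (1 : ℝ) 0 1).add this).const_mul _
    · by_cases hz : f z = 0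
      · simp [hL, hz, hp.ne']
      · have hz' : 0 < ‖f z‖ := norm_pos_iff.2 hz
        simp only [hL, hz, if_false]
        have := add_one_le_exp (p * (log ‖f z‖ - log ‖f 0‖))
        calc _ ≤ ‖f 0‖ ^ p * exp (p * (log ‖f z‖ - log ‖f 0‖)) := by gcongr; linarith
          _ = ‖f z‖ ^ p := by
            rw [rpow_def_of_pos ha, rpow_def_of_pos hz', ← exp_add]; congr 1; ring
  refine le_trans ?_ hle
  have key : circleAverage (fun z ↦ ‖f 0‖ ^ p * (1 + p * (L z - log ‖f 0‖))) 0 1 =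
      ‖f 0‖ ^ p * (1 + p * (circleAverage L 0 1 - log ‖f 0‖)) := by
    have e : (fun z ↦ ‖f 0‖ ^ p * (1 + p * (L z - log ‖f 0‖))) =
        (fun _ ↦ ‖f 0‖ ^ p * (1 - p * log ‖f 0‖)) + (‖f 0‖ ^ p * p) • L := by
      ext z; simp; ring
    have hs : CircleIntegrable ((‖f 0‖ ^ p * p) • L) 0 1 := hLi.const_mul _
    rw [e, circleAverage_add (circleIntegrable_const _ 0 1) hs,
      circleAverage_const, circleAverage_smul, smul_eq_mul]
    ring
  rw [key]
  have : 0 ≤ p * (circleAverage L 0 1 - log ‖f 0‖) := mul_nonneg hp.le (by linarith)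
  exact le_mul_of_one_le_right (by positivity) (by linarith)

open Metric Real in
theorem enorm_rpow_le_lintegral_circle {f : ℂ → ℂ} {p : ℝ} (hp : 0 < p)
    (hf : AnalyticOnNhd ℂ f (closedBall 0 1)) :
    ENNReal.ofReal (2 * π) * ‖f 0‖ₑ ^ p ≤
      ∫⁻ θ in Set.Ioc 0 (2 * π), ‖f (circleMap 0 1 θ)‖ₑ ^ p := by
  have h := norm_rpow_le_circleAverage hp hf
  have hpow : CircleIntegrable (fun z ↦ ‖f z‖ ^ p) 0 1 := by
    apply ContinuousOn.circleIntegrable zero_le_one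
    exact ((hf.continuousOn.mono sphere_subset_closedBall).norm).rpow_const
      fun _ _ ↦ Or.inr hp.le
  rw [circleAverage_def, smul_eq_mul, intervalIntegral.integral_of_le two_pi_pos.le,
    ← div_eq_inv_mul, le_div_iff₀' two_pi_pos] at h
  have hi := (intervalIntegrable_iff_integrableOn_Ioc_of_le two_pi_pos.le).1 hpow
  have e (z : ℂ) : ‖f z‖ₑ ^ p = ENNReal.ofReal (‖f z‖ ^ p) := by
    rw [← ofReal_norm, ENNReal.ofReal_rpow_of_nonneg (norm_nonneg _) hp.le]
  simp_rw [e]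
  rw [← ofReal_integral_eq_lintegral_ofReal hi (ae_of_all _ fun _ ↦ by positivity),
    ← ENNReal.ofReal_mul (by positivity)]
  exact ENNReal.ofReal_le_ofReal h

theorem measurePreserving_smul_pi {n : ℕ} {u : ℂ} (hu : ‖u‖ = 1) :
    MeasurePreserving (fun z : Fin n → ℂ ↦ u • z) := by
  have h1 : MeasurePreserving (fun w : ℂ ↦ u * w) :=
    (rotation ⟨u, by simpa [Submonoid.unitSphere] using hu⟩).measurePreserving
  exact volume_preserving_pi (fun _ : Fin n ↦ h1)

open Metric Real in
/-- Sub-mean value inequality for `|f| ^ p` on a polydisc, for every exponent `p > 0`, by averaging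
over the rotations `z ↦ exp (i θ) z`. -/
theorem enorm_rpow_mul_volume_ball_le {n : ℕ} {f : (Fin n → ℂ) → ℂ} {p r : ℝ} (hp : 0 < p)
    {x : Fin n → ℂ} (hf : DifferentiableOn ℂ f (ball x r)) :
    ‖f x‖ₑ ^ p * volume (ball x r) ≤ ∫⁻ z in ball x r, ‖f z‖ₑ ^ p := by
  set F : (Fin n → ℂ) → ℝ≥0∞ := (ball 0 r).indicator fun z ↦ ‖f (x + z)‖ₑ ^ p with hF
  have hmaps : Set.MapsTo (fun z ↦ x + z) (ball 0 r) (ball x r) := fun z hz ↦ by simpa using hz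
  have hcont : ContinuousOn (fun z ↦ f (x + z)) (ball 0 r) :=
    hf.continuousOn.comp (by fun_prop) hmaps
  have hFm : Measurable F := by
    have h1 : ContinuousOn (fun z ↦ ‖f (x + z)‖ₑ ^ p) (ball 0 r) :=
      ENNReal.continuous_rpow_const.comp_continuousOn
        (continuous_enorm.comp_continuousOn hcont)
    classical
    have h2 := h1.measurable_piecewise (g := 0) continuous_zero.continuousOn
      measurableSet_ball
    rwa [Set.piecewise_eq_indicator] at h2
  have hint : ∫⁻ z in ball x r, ‖f z‖ₑ ^ p = ∫⁻ z, F z := by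
    rw [← lintegral_indicator measurableSet_ball, ← lintegral_add_left_eq_self _ x]
    congr 1 with z
    simp only [hF, Set.indicator, mem_ball, dist_self_add_left, dist_zero_right]
  have hrot (θ : ℝ) : ∫⁻ z, F (circleMap 0 1 θ • z) = ∫⁻ z, F z :=
    (measurePreserving_smul_pi (n := n) (u := circleMap 0 1 θ) (by simp)).lintegral_comp hFm
  have hslice (z : Fin n → ℂ) (hz : z ∈ ball 0 r) : ENNReal.ofReal (2 * π) * ‖f x‖ₑ ^ p ≤
      ∫⁻ θ in Set.Ioc 0 (2 * π), F (circleMap 0 1 θ • z) := by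
    have hz' : ‖z‖ < r := by simpa using hz
    have hg : AnalyticOnNhd ℂ (fun ζ : ℂ ↦ f (x + ζ • z)) (closedBall 0 1) := by
      have ho : IsOpen ((fun ζ : ℂ ↦ x + ζ • z) ⁻¹' ball x r) :=
        isOpen_ball.preimage (by fun_prop)
      have hd : DifferentiableOn ℂ (fun ζ : ℂ ↦ f (x + ζ • z))
          ((fun ζ : ℂ ↦ x + ζ • z) ⁻¹' ball x r) :=
        hf.comp (by fun_prop) fun _ h ↦ h
      refine (hd.analyticOnNhd ho).mono fun ζ hζ ↦ ?_
      have : ‖ζ‖ ≤ 1 := by simpa using hζ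
      simp only [Set.mem_preimage, mem_ball, dist_self_add_left, norm_smul]
      nlinarith [norm_nonneg z]
    have h := enorm_rpow_le_lintegral_circle hp hg
    simp only [zero_smul, add_zero] at h
    refine h.trans (le_of_eq (lintegral_congr fun θ ↦ ?_))
    have : circleMap 0 1 θ • z ∈ ball (0 : Fin n → ℂ) r := by simpa [norm_smul] using hz'
    simp [hF, this]
  have hpi0 : ENNReal.ofReal (2 * π) ≠ 0 := by simp [pi_pos]
  refine (ENNReal.mul_le_mul_iff_right hpi0 ENNReal.ofReal_ne_top).1 ?_
  have hvol : volume (ball x r) = volume (ball (0 : Fin n → ℂ) r) :=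
    Measure.addHaar_ball_center _ _ _
  calc ENNReal.ofReal (2 * π) * (‖f x‖ₑ ^ p * volume (ball x r))
      = ∫⁻ _ in ball (0 : Fin n → ℂ) r, ENNReal.ofReal (2 * π) * ‖f x‖ₑ ^ p := by
        rw [setLIntegral_const, hvol, mul_assoc]
    _ ≤ ∫⁻ z in ball (0 : Fin n → ℂ) r, ∫⁻ θ in Set.Ioc 0 (2 * π), F (circleMap 0 1 θ • z) :=
        setLIntegral_mono' measurableSet_ball hslice
    _ ≤ ∫⁻ z, ∫⁻ θ in Set.Ioc 0 (2 * π), F (circleMap 0 1 θ • z) := setLIntegral_le_lintegral _ _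
    _ = ∫⁻ θ in Set.Ioc 0 (2 * π), ∫⁻ z, F (circleMap 0 1 θ • z) := by
        refine lintegral_lintegral_swap (Measurable.aemeasurable ?_)
        exact hFm.comp (by fun_prop)
    _ = ENNReal.ofReal (2 * π) * ∫⁻ z in ball x r, ‖f z‖ₑ ^ p := by
        simp_rw [hrot, setLIntegral_const, hint]
        simp [mul_comm]

theorem enorm_sum_mul_sq_le {ι : Type*} [Fintype ι] (c v : ι → ℂ)
    (hc : ∑ i, ‖c i‖ ^ 2 ≤ 1) : ‖∑ i, c i * v i‖ₑ ^ 2 ≤ ∑ i, ‖v i‖ₑ ^ 2 := by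
  have hv : 0 ≤ ∑ i, ‖v i‖ ^ 2 := Finset.sum_nonneg fun _ _ ↦ by positivity
  have h : ‖∑ i, c i * v i‖ ^ 2 ≤ ∑ i, ‖v i‖ ^ 2 :=
    calc ‖∑ i, c i * v i‖ ^ 2 ≤ (∑ i, ‖c i‖ * ‖v i‖) ^ 2 := by
          gcongr
          exact (norm_sum_le _ _).trans_eq (by simp)
      _ ≤ (∑ i, ‖c i‖ ^ 2) * ∑ i, ‖v i‖ ^ 2 := Finset.sum_mul_sq_le_sq_mul_sq _ _ _
      _ ≤ ∑ i, ‖v i‖ ^ 2 := mul_le_of_le_one_left hv hc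
  have e (w : ℂ) : ‖w‖ₑ ^ 2 = ENNReal.ofReal (‖w‖ ^ 2) := by
    rw [← ofReal_norm, ENNReal.ofReal_pow (norm_nonneg _)]
  simp_rw [e]
  rw [← ENNReal.ofReal_sum_of_nonneg fun _ _ ↦ by positivity]
  exact ENNReal.ofReal_le_ofReal h

/-- The elements of the unit ball of `V` for the weight `1 / k` are dominated on `D` by a family of
at most `dim V` unit vectors, the lifts of an orthonormal basis of the image of `V` in `L²`. -/
theorem exists_dominating_family_of_unit_ball
    {X : Type*} [TopologicalSpace X] [MeasurableSpace X] [BorelSpace X] {μ : Measure X}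
    [μ.IsOpenPosMeasure] {D : Set X} {V : Submodule ℂ (X → ℂ)} [FiniteDimensional ℂ V]
    {k : X → ℝ≥0∞} (hD : IsOpen D)
    (hV : ∀ f ∈ V, ContinuousOn f D) (hk : AEMeasurable k (μ.restrict D))
    (hkt : ∀ z ∈ D, k z ≠ ∞) :
    ∃ (d : ℕ) (e : Fin d → X → ℂ), d ≤ Module.finrank ℂ V ∧ (∀ i, e i ∈ V) ∧
      (∀ i, ∫⁻ z in D, ‖e i z‖ₑ ^ 2 / k z ∂μ ≤ 1) ∧
      ∀ σ ∈ V, ∫⁻ z in D, ‖σ z‖ₑ ^ 2 / k z ∂μ ≤ 1 →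
        ∀ z ∈ D, ‖σ z‖ₑ ^ 2 ≤ ∑ i, ‖e i z‖ₑ ^ 2 := by
  set ρ : Measure X := (μ.restrict D).withDensity k⁻¹ with hρ
  have hac : ρ ≪ μ.restrict D := withDensity_absolutelyContinuous _ _
  have hac' : μ.restrict D ≪ ρ := by
    refine withDensity_absolutelyContinuous' hk.inv ?_
    filter_upwards [ae_restrict_mem hD.measurableSet] with z hz
    simpa using hkt z hz
  have hsm (f) (hf : f ∈ V) : AEStronglyMeasurable f (μ.restrict D) :=
    (hV f hf).aestronglyMeasurable hD.measurableSet
  have hnorm (f) (hf : f ∈ V) : eLpNorm f 2 ρ ^ 2 = ∫⁻ z in D, ‖f z‖ₑ ^ 2 / k z ∂μ := by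
    have h1 := eLpNorm_nnreal_pow_eq_lintegral (μ := ρ) (f := f) (p := 2) two_ne_zero
    norm_num at h1
    rw [h1, hρ, lintegral_withDensity_eq_lintegral_mul₀ hk.inv
      ((hsm f hf).enorm.pow_const 2)]
    exact lintegral_congr fun z ↦ by simp [div_eq_mul_inv, mul_comm]
  let W : Submodule ℂ (X → ℂ) :=
    { carrier := {f | f ∈ V ∧ MemLp f 2 ρ}
      add_mem' := fun ha hb ↦ ⟨V.add_mem ha.1 hb.1, ha.2.add hb.2⟩
      zero_mem' := ⟨V.zero_mem, MemLp.zero⟩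
      smul_mem' := fun c _ h ↦ ⟨V.smul_mem c h.1, h.2.const_smul c⟩ }
  have hWV : W ≤ V := fun _ h ↦ h.1
  have : FiniteDimensional ℂ W := Submodule.finiteDimensional_of_le hWV
  let T : W →ₗ[ℂ] Lp ℂ 2 ρ :=
    { toFun := fun f ↦ f.2.2.toLp f.1
      map_add' := fun f g ↦ MemLp.toLp_add f.2.2 g.2.2
      map_smul' := fun c f ↦ MemLp.toLp_const_smul c f.2.2 }
  let b := stdOrthonormalBasis ℂ (LinearMap.range T)
  have hpre (i) : ∃ w : W, T w = (b i : Lp ℂ 2 ρ) := (b i).2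
  choose e he using hpre
  refine ⟨_, fun i ↦ (e i).1, ?_, fun i ↦ (e i).2.1, fun i ↦ ?_, fun σ hσ hσ1 z hz ↦ ?_⟩
  · exact (LinearMap.finrank_range_le T).trans (Submodule.finrank_mono hWV)
  · rw [← hnorm _ (e i).2.1]
    have h1 : ‖T (e i)‖ₑ = eLpNorm (e i).1 2 ρ := Lp.enorm_toLp (e i).2.2
    have h2 : ‖(b i : Lp ℂ 2 ρ)‖ = 1 := b.orthonormal.1 i
    rw [← h1, he, ← ofReal_norm, h2]
    simp
  · have hσ2 : eLpNorm σ 2 ρ ≤ 1 := by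
      rw [← hnorm σ hσ] at hσ1
      by_contra! h
      exact absurd hσ1 (not_le.2 (one_lt_pow₀ h two_ne_zero))
    have hσW : MemLp σ 2 ρ := ⟨(hsm σ hσ).mono_ac hac, hσ2.trans_lt ENNReal.one_lt_top⟩
    let s : W := ⟨σ, hσ, hσW⟩
    let t : LinearMap.range T := ⟨T s, s, rfl⟩
    have ht : ‖t‖ ≤ 1 := by
      have h1 : ‖T s‖ₑ = eLpNorm σ 2 ρ := Lp.enorm_toLp hσW
      rw [← h1, ← ofReal_norm] at hσ2
      exact ENNReal.ofReal_le_one.1 hσ2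
    set c := fun i ↦ b.repr t i with hc
    have hsum : ∑ i, ‖c i‖ ^ 2 ≤ 1 := by
      rw [← EuclideanSpace.norm_sq_eq, b.repr.norm_map]
      exact pow_le_one₀ (norm_nonneg _) ht
    have hTs : T s = T (∑ i, c i • e i) := by
      have h1 : T s = ((∑ i, c i • b i : LinearMap.range T) : Lp ℂ 2 ρ) :=
        congrArg Subtype.val (b.sum_repr t).symm
      rw [h1, map_sum]
      simp [he]
    have hae : σ =ᵐ[μ.restrict D] (∑ i, c i • e i : W).1 :=
      hac'.ae_eq ((MemLp.toLp_eq_toLp_iff s.2.2 (∑ i, c i • e i : W).2.2).1 hTs)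
    have heq := Measure.eqOn_open_of_ae_eq hae hD (hV _ hσ)
      (hV _ (∑ i, c i • e i : W).2.1) hz
    rw [heq]
    simpa using enorm_sum_mul_sq_le c (fun i ↦ (e i).1 z) hsum

/-- The extremal function of the unit ball of `V` with respect to the weight `1 / k`. -/
noncomputable def extremalKernel {X : Type*} [MeasurableSpace X]
    (μ : Measure X) (D : Set X) (V : Submodule ℂ (X → ℂ))
    (k : X → ℝ≥0∞) (x : X) : ℝ≥0∞ :=
  ⨆ σ : {σ : X → ℂ // σ ∈ V ∧ ∫⁻ z in D, ‖σ z‖ₑ ^ 2 / k z ∂μ ≤ 1}, ‖σ.1 x‖ₑ ^ 2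

theorem aemeasurable_extremalKernel
    {X : Type*} [TopologicalSpace X] [MeasurableSpace X] [BorelSpace X] {μ : Measure X}
    {D : Set X} {V : Submodule ℂ (X → ℂ)} {k : X → ℝ≥0∞} (hD : IsOpen D)
    (hV : ∀ f ∈ V, ContinuousOn f D) :
    AEMeasurable (extremalKernel μ D V k) (μ.restrict D) := by
  refine aemeasurable_restrict_of_measurable_subtype hD.measurableSet ?_
  refine LowerSemicontinuous.measurable (lowerSemicontinuous_iSup fun σ ↦ ?_)
  refine Continuous.lowerSemicontinuous ?_
  have := (hV σ.1 σ.2.1).domRestrict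
  exact (ENNReal.continuous_pow 2).comp (continuous_enorm.comp this)

/-- The Bergman kernel has total mass at most `dim V` against the weight. -/
theorem lintegral_extremalKernel_div_le
    {X : Type*} [TopologicalSpace X] [MeasurableSpace X] [BorelSpace X] {μ : Measure X}
    [μ.IsOpenPosMeasure] {D : Set X} {V : Submodule ℂ (X → ℂ)} [FiniteDimensional ℂ V]
    {k : X → ℝ≥0∞} (hD : IsOpen D)
    (hV : ∀ f ∈ V, ContinuousOn f D) (hk : AEMeasurable k (μ.restrict D))
    (hkt : ∀ z ∈ D, k z ≠ ∞) :
    ∫⁻ z in D, extremalKernel μ D V k z / k z ∂μ ≤ Module.finrank ℂ V := by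
  obtain ⟨d, e, hd, heV, he, hle⟩ :=
    exists_dominating_family_of_unit_ball hD hV hk hkt
  calc ∫⁻ z in D, extremalKernel μ D V k z / k z ∂μ
      ≤ ∫⁻ z in D, ∑ i, ‖e i z‖ₑ ^ 2 / k z ∂μ := by
        refine setLIntegral_mono' hD.measurableSet fun z hz ↦ ?_
        simp only [div_eq_mul_inv]
        rw [← Finset.sum_mul]
        gcongr
        exact iSup_le fun σ ↦ hle σ.1 σ.2.1 σ.2.2 z hz
    _ = ∑ i, ∫⁻ z in D, ‖e i z‖ₑ ^ 2 / k z ∂μ := by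
        refine lintegral_finsetSum' _ fun i _ ↦ ?_
        exact ((((hV _ (heV i)).aestronglyMeasurable hD.measurableSet).enorm).pow_const 2).div hk
    _ ≤ ∑ _i : Fin d, 1 := Finset.sum_le_sum fun i _ ↦ he i
    _ ≤ Module.finrank ℂ V := by simpa using hd

theorem ae_extremalKernel_le_div_mul
    {X : Type*} [TopologicalSpace X] [MeasurableSpace X] [BorelSpace X] {μ : Measure X}
    [μ.IsOpenPosMeasure] {D : Set X} {V : Submodule ℂ (X → ℂ)} [FiniteDimensional ℂ V]
    {k : X → ℝ≥0∞} (hD : IsOpen D)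
    (hV : ∀ f ∈ V, ContinuousOn f D) (hk : AEMeasurable k (μ.restrict D))
    (hkt : ∀ z ∈ D, k z ≠ ∞) :
    ∀ᵐ z ∂μ.restrict D, extremalKernel μ D V k z ≤ extremalKernel μ D V k z / k z * k z := by
  have hm := (aemeasurable_extremalKernel (μ := μ) (k := k) hD hV).div hk
  have hfin := ae_lt_top' hm ((lintegral_extremalKernel_div_le hD hV hk hkt).trans_lt
    (ENNReal.natCast_lt_top _)).ne
  filter_upwards [hfin, ae_restrict_mem hD.measurableSet] with z hz hzD
  rcases eq_or_ne (k z) 0 with h0 | h0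
  · by_contra! h
    have : extremalKernel μ D V k z ≠ 0 := (pos_of_gt h).ne'
    simp only [Pi.div_apply, h0, ENNReal.div_zero this, lt_self_iff_false] at hz
  · exact (ENNReal.div_mul_cancel h0 (hkt z hzD)).ge

theorem ae_le_prod_div_of_eq_extremalKernel
    {X : Type*} [TopologicalSpace X] [MeasurableSpace X] [BorelSpace X] {μ : Measure X}
    [μ.IsOpenPosMeasure] {D : Set X} {V : ℕ → Submodule ℂ (X → ℂ)}
    [∀ m, FiniteDimensional ℂ (V m)] {K : ℕ → X → ℝ≥0∞} (hD : IsOpen D)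
    (hV : ∀ m, ∀ f ∈ V m, ContinuousOn f D) (hK0 : ∀ x, K 0 x = 1)
    (hK : ∀ m, K (m + 1) = extremalKernel μ D (V (m + 1)) (K m))
    (hm : ∀ m, AEMeasurable (K m) (μ.restrict D)) (m : ℕ)
    (hfin : ∀ j < m, ∀ z ∈ D, K j z ≠ ∞) :
    ∀ᵐ z ∂μ.restrict D, K m z ≤ ∏ j ∈ Finset.range m, K (j + 1) z / K j z := by
  induction m with
  | zero => simp [hK0]
  | succ m ih =>
    have h := ae_extremalKernel_le_div_mul hD (hV (m + 1)) (hm m) (hfin m m.lt_succ_self)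
    rw [← hK] at h
    filter_upwards [h, ih fun j hj ↦ hfin j (hj.trans m.lt_succ_self)] with z hz hz'
    rw [Finset.prod_range_succ, mul_comm]
    exact hz.trans (by gcongr)

open Metric in
/-- The sub-mean value inequality for `|f| ^ (2 / m)` combined with Hölder's inequality for `m`
factors. -/
theorem enorm_sq_le_prod_lintegral_div {n : ℕ} {f : (Fin n → ℂ) → ℂ} {x : Fin n → ℂ} {r : ℝ}
    (hr : 0 < r) (hf : DifferentiableOn ℂ f (ball x r)) {m : ℕ} (hm : m ≠ 0)
    {Q : ℕ → (Fin n → ℂ) → ℝ≥0∞}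
    (hQ : ∀ j < m, AEMeasurable (Q j) (volume.restrict (ball x r)))
    (hle : ∀ᵐ z ∂volume.restrict (ball x r), ‖f z‖ₑ ^ 2 ≤ ∏ j ∈ Finset.range m, Q j z) :
    ‖f x‖ₑ ^ 2 ≤ ∏ j ∈ Finset.range m, ((∫⁻ z in ball x r, Q j z) / volume (ball x r)) := by
  have hm' : (m : ℝ) ≠ 0 := by exact_mod_cast hm
  have hp : (0 : ℝ) < 2 * (m : ℝ)⁻¹ := by positivity
  have hinv : (0 : ℝ) ≤ (m : ℝ)⁻¹ := by positivity
  have hsq (a : ℝ≥0∞) : a ^ (2 * (m : ℝ)⁻¹) = (a ^ 2) ^ (m : ℝ)⁻¹ := by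
    rw [ENNReal.rpow_mul, ENNReal.rpow_two]
  have hv0 : volume (ball x r) ≠ 0 := (measure_ball_pos _ _ hr).ne'
  have hvt : volume (ball x r) ≠ ∞ := measure_ball_lt_top.ne
  have h : (‖f x‖ₑ ^ 2) ^ (m : ℝ)⁻¹ * volume (ball x r) ≤
      (∏ j ∈ Finset.range m, ∫⁻ z in ball x r, Q j z) ^ (m : ℝ)⁻¹ :=
    calc (‖f x‖ₑ ^ 2) ^ (m : ℝ)⁻¹ * volume (ball x r)
        ≤ ∫⁻ z in ball x r, (‖f z‖ₑ ^ 2) ^ (m : ℝ)⁻¹ := by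
          simpa only [hsq] using enorm_rpow_mul_volume_ball_le hp hf
      _ ≤ ∫⁻ z in ball x r, ∏ j ∈ Finset.range m, Q j z ^ (m : ℝ)⁻¹ := by
          refine lintegral_mono_ae ?_
          filter_upwards [hle] with z hz
          rw [ENNReal.prod_rpow_of_nonneg hinv]
          gcongr
      _ ≤ ∏ j ∈ Finset.range m, (∫⁻ z in ball x r, Q j z) ^ (m : ℝ)⁻¹ :=
          ENNReal.lintegral_prod_norm_pow_le _ (fun j hj ↦ hQ j (Finset.mem_range.1 hj))
            (by simp [hm']) fun _ _ ↦ hinv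
      _ = _ := ENNReal.prod_rpow_of_nonneg hinv
  have h' := pow_le_pow_left₀ zero_le h m
  rw [mul_pow, ENNReal.rpow_inv_natCast_pow hm, ENNReal.rpow_inv_natCast_pow hm] at h'
  simp only [div_eq_mul_inv]
  rw [Finset.prod_mul_distrib, Finset.prod_const, Finset.card_range, ← ENNReal.inv_pow,
    ← div_eq_mul_inv, ENNReal.le_div_iff_mul_le (Or.inl (by simp [hv0])) (Or.inl (by simp [hvt]))]
  exact h'

theorem prod_ofReal_mul_rpow_eq (c ν : ℝ) (hc : 0 ≤ c) (m : ℕ) :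
    ∏ j ∈ Finset.range m, ENNReal.ofReal (c * ((j + 1 : ℕ) : ℝ) ^ ν) =
      ENNReal.ofReal (c ^ m * (Nat.factorial m : ℝ) ^ ν) := by
  rw [← ENNReal.ofReal_prod_of_nonneg fun _ _ ↦ by positivity]
  congr 1
  rw [Finset.prod_mul_distrib, Finset.prod_const, Finset.card_range,
    Real.finsetProd_rpow _ _ fun _ _ ↦ by positivity, ← Finset.prod_range_add_one_eq_factorial]
  push_cast
  rfl

open Metric in
theorem le_prod_finrank_div_of_eq_extremalKernel {n : ℕ} {D : Set (Fin n → ℂ)} (hD : IsOpen D)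
    {V : ℕ → Submodule ℂ ((Fin n → ℂ) → ℂ)} [∀ m, FiniteDimensional ℂ (V m)]
    (hV : ∀ m, ∀ f ∈ V m, DifferentiableOn ℂ f D) {K : ℕ → (Fin n → ℂ) → ℝ≥0∞}
    (hK0 : ∀ x, K 0 x = 1)
    (hK : ∀ m, K (m + 1) = extremalKernel volume D (V (m + 1)) (K m)) (m : ℕ) :
    ∀ (x : Fin n → ℂ) (r : ℝ), 0 < r → ball x r ⊆ D →
      K m x ≤ ∏ j ∈ Finset.range m, (Module.finrank ℂ (V (j + 1)) / volume (ball x r)) := by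
  have hVc (m) (f) (hf : f ∈ V m) : ContinuousOn f D := (hV m f hf).continuousOn
  have hmeas (m) : AEMeasurable (K m) (volume.restrict D) := by
    cases m with
    | zero => simpa only [funext hK0] using aemeasurable_const
    | succ m => rw [hK]; exact aemeasurable_extremalKernel hD (hVc _)
  induction m using Nat.strong_induction_on with
  | _ m ih =>
  intro x r hr hxr
  rcases m with _ | m
  · simp [hK0]
  have hfin (j) (hj : j < m + 1) (z) (hz : z ∈ D) : K j z ≠ ∞ := by
    obtain ⟨s, hs, hzs⟩ := isOpen_iff.1 hD z hz
    refine ((ih j hj z s hs hzs).trans_lt (ENNReal.prod_lt_top fun i _ ↦ ?_)).ne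
    exact ENNReal.div_lt_top (ENNReal.natCast_ne_top _) (measure_ball_pos _ _ hs).ne'
  have hle := ae_le_prod_div_of_eq_extremalKernel hD hVc hK0 hK hmeas (m + 1) hfin
  rw [hK, extremalKernel]
  refine iSup_le fun σ ↦ ?_
  refine (enorm_sq_le_prod_lintegral_div hr ((hV _ _ σ.2.1).mono hxr) m.succ_ne_zero
    (Q := fun j z ↦ K (j + 1) z / K j z)
    (fun j _ ↦ ((hmeas _).div (hmeas _)).mono_set hxr) ?_).trans ?_
  · filter_upwards [ae_restrict_of_ae_restrict_of_subset hxr hle] with z hz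
    refine le_trans ?_ hz
    rw [hK]
    exact le_iSup (fun τ : {τ : (Fin n → ℂ) → ℂ // τ ∈ V (m + 1) ∧
      ∫⁻ z in D, ‖τ z‖ₑ ^ 2 / K m z ≤ 1} ↦ ‖τ.1 z‖ₑ ^ 2) σ
  · refine Finset.prod_le_prod' fun j hj ↦ ?_
    gcongr
    refine (lintegral_mono_set hxr).trans ?_
    rw [hK]
    exact lintegral_extremalKernel_div_le hD (hVc _) (hmeas j) (hfin j (Finset.mem_range.1 hj))

/-- **Factorial-type upper bound in the dynamical construction of the AZD
(local model on a polydisk).**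
`D ⊆ ℂⁿ` is a bounded domain (e.g. a polydisk) with Lebesgue volume `dV`,
`V_m ⊆ O(D)` are finite-dimensional spaces with `dim V_m ≤ C m^ν`, and the
Bergman kernels are defined recursively by the extremal problem
`K_m(x) = sup { |σ(x)|² : σ ∈ V_m, ∫_D |σ|²/K_{m-1} dV ≤ 1 }`, `K₀ = 1`.
Then (by the plurisubharmonic sub-mean value inequality, by induction) there
is a constant `C₁ > 0` with `K_m ≤ C₁^m (m!)^ν dV^m` pointwise on compact
subsets of `D`. -/
theorem azd_dynamical_upper_bound
    {n : ℕ} (D : Set (Fin n → ℂ)) (hDo : IsOpen D)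
    (hDb : Bornology.IsBounded D) (hDne : D.Nonempty)
    (C ν : ℝ) (hC : 0 < C) (hν : 0 ≤ ν)
    (V : ℕ → Submodule ℂ ((Fin n → ℂ) → ℂ))
    (hfd : ∀ m, FiniteDimensional ℂ (V m))
    (hhol : ∀ m, ∀ f ∈ V m, DifferentiableOn ℂ f D)
    (hdim : ∀ m : ℕ, 0 < m → ((Module.finrank ℂ (V m) : ℝ)) ≤ C * (m : ℝ) ^ ν)
    (K : ℕ → (Fin n → ℂ) → ℝ≥0∞)
    (hK0 : ∀ x, K 0 x = 1)
    (hKrec : ∀ (m : ℕ) (x : Fin n → ℂ),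
      K (m + 1) x =
        ⨆ σ : {σ : (Fin n → ℂ) → ℂ // σ ∈ V (m + 1) ∧
            (∫⁻ z in D, ((‖σ z‖₊ : ℝ≥0∞)) ^ 2 / K m z) ≤ 1},
          ((‖σ.1 x‖₊ : ℝ≥0∞)) ^ 2) :
    ∀ A : Set (Fin n → ℂ), A ⊆ D → IsCompact A →
      ∃ C₁ : ℝ, 0 < C₁ ∧ ∀ (m : ℕ), ∀ x ∈ A,
        K m x ≤ ENNReal.ofReal (C₁ ^ m * ((Nat.factorial m : ℝ)) ^ ν) := by
  intro A hAD hA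
  have hK (m : ℕ) : K (m + 1) = extremalKernel volume D (V (m + 1)) (K m) := funext (hKrec m)
  obtain ⟨r, hr, hrD⟩ := hA.exists_thickening_subset_open hDo hAD
  set v : ℝ≥0∞ := volume (Metric.ball (0 : Fin n → ℂ) r) with hv
  have hv0 : 0 < v.toReal :=
    ENNReal.toReal_pos (Metric.measure_ball_pos _ _ hr).ne' measure_ball_lt_top.ne
  refine ⟨C / v.toReal, by positivity, fun m x hx ↦ ?_⟩
  have hxr : Metric.ball x r ⊆ D := (Metric.ball_subset_thickening hx r).trans hrD
  rw [← prod_ofReal_mul_rpow_eq _ _ (by positivity)]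
  refine (le_prod_finrank_div_of_eq_extremalKernel hDo hhol hK0 hK m x r hr hxr).trans
    (Finset.prod_le_prod' fun j _ ↦ ?_)
  rw [Measure.addHaar_ball_center, ← hv, div_mul_eq_mul_div, ENNReal.ofReal_div_of_pos hv0,
    ENNReal.ofReal_toReal measure_ball_lt_top.ne, ← ENNReal.ofReal_natCast]
  gcongr
  exact hdim (j + 1) j.succ_pos
end
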